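/- Let (W,S) be a Coxeter system and suppose the reduced expressions of two group elements use the same generators in a way that any sequence of braid moves applicable in a Coxeter group W' with componentwise larger Coxeter matrix is also applicable in W. Then if W contains an infinite antichain in the right weak order, so does any Coxeter group W' obtained from W by increasing edge labels of the Coxeter diagram. -/

import Mathlib

/-- The right weak order on a Coxeter group: `v ≤_R w` iff `ℓ(v) + ℓ(v⁻¹w) = ℓ(w)`. -/
def weakLE {B : Type*} {W : Type*} [Group W] {M : CoxeterMatrix B}
    (cs : CoxeterSystem M W) (v w : W) : Prop :=
  cs.length v + cs.length (v⁻¹ * w) = cs.length w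

namespace CoxeterMatrix

open Module Polynomial.Chebyshev

variable {B : Type*} (M : CoxeterMatrix B)

/-- The Cartan matrix `-2 cos (π / M i j)` of a Coxeter matrix, equal to `-2` if `M i j = ∞`. -/
noncomputable def geomCartan (i j : B) : ℝ :=
  if M i j = 0 then -2 else -2 * Real.cos (Real.pi / M i j)

theorem geomCartan_comm (i j : B) : M.geomCartan i j = M.geomCartan j i := by
  simp only [geomCartan, M.symmetric i j]

theorem geomCartan_of_eq_two {i j : B} (h : M i j = 2) : M.geomCartan i j = 0 := by
  simp [geomCartan, h]

theorem geomCartan_mul_sub_two {i j : B} (h : M i j ≠ 0) :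
    M.geomCartan i j * M.geomCartan j i - 2 = 2 * Real.cos (2 * Real.pi / M i j) := by
  rw [M.geomCartan_comm j i, geomCartan, if_neg h, mul_div_assoc, Real.cos_two_mul]
  ring

/-- The linear form `2 ⟨αᵢ, ·⟩` on the space with basis the simple roots. -/
noncomputable def geomCoroot (i : B) : Dual ℝ (B →₀ ℝ) :=
  Finsupp.linearCombination ℝ (M.geomCartan i)

theorem geomCoroot_single (i j : B) :
    M.geomCoroot i (Finsupp.single j 1) = M.geomCartan i j := by
  simp [geomCoroot]

theorem geomCoroot_single_self (i : B) : M.geomCoroot i (Finsupp.single i 1) = 2 := by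
  simp [geomCoroot_single, geomCartan]

/-- The simple reflections of the geometric representation. -/
noncomputable def geomReflection (i : B) : (B →₀ ℝ) ≃ₗ[ℝ] (B →₀ ℝ) :=
  reflection (M.geomCoroot_single_self i)

theorem sin_two_pi_div_pos {m : ℕ} (hm : 3 ≤ m) : 0 < Real.sin (2 * Real.pi / m) := by
  have hm' : (3 : ℝ) ≤ m := by exact_mod_cast hm
  apply Real.sin_pos_of_pos_of_lt_pi
  · have := Real.pi_pos
    positivity
  · rw [div_lt_iff₀ (by linarith)]
    nlinarith [Real.pi_pos]

theorem chebyshevS_mul_sin (m : ℕ) (n : ℤ) :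
    (S ℝ n).eval (2 * Real.cos (2 * Real.pi / m)) * Real.sin (2 * Real.pi / m) =
      Real.sin ((n + 1) * (2 * Real.pi / m)) := by
  simp

theorem geomReflection_isLiftable : M.IsLiftable M.geomReflection := by
  intro i j
  by_cases hij : i = j
  · subst hij
    ext1 x
    simp only [M.diagonal, pow_one, LinearEquiv.mul_apply]
    exact involutive_reflection _ x
  rcases Nat.lt_or_ge (M i j) 3 with h3 | h3
  · have h1 := M.off_diagonal i j hij
    obtain h | h : M i j = 0 ∨ M i j = 2 := by omega
    · simp [h]
    · have h0 := M.geomCartan_of_eq_two h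
      have h0' : M.geomCartan j i = 0 := by rw [geomCartan_comm, h0]
      ext1 x
      simp only [h, pow_two, LinearEquiv.mul_apply, geomReflection, reflection_apply, map_sub,
        map_smul, geomCoroot_single_self, M.geomCoroot_single i j, M.geomCoroot_single j i,
        h0, h0', LinearEquiv.coe_one, id]
      module
  · set m := M i j with hm
    have hm0 : (m : ℝ) ≠ 0 := by positivity
    have hs := (sin_two_pi_div_pos h3).ne'
    ext1 x
    have ht : 2 * Real.cos (2 * Real.pi / m) =
        M.geomCoroot i (Finsupp.single j 1) * M.geomCoroot j (Finsupp.single i 1) - 2 := by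
      rw [geomCoroot_single, geomCoroot_single, geomCartan_mul_sub_two _ (by omega)]
    rw [geomReflection, geomReflection, reflection_mul_reflection_pow_apply _ _ _ _ _ ht]
    obtain ⟨k, hk | hk⟩ := Nat.even_or_odd' m
    · have hS : (S ℝ (k - 1)).eval (2 * Real.cos (2 * Real.pi / m)) = 0 := by
        apply mul_right_cancel₀ hs
        rw [chebyshevS_mul_sin, zero_mul]
        have : (((k : ℤ) - 1 : ℤ) + 1 : ℝ) * (2 * Real.pi / m) = Real.pi := by
          have : (m : ℝ) = 2 * k := by exact_mod_cast hk
          push_cast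
          field_simp
          linear_combination -this
        rw [this, Real.sin_pi]
      rw [show ((m : ℤ) - 2) / 2 = k - 1 by omega, show ((m : ℤ) - 1) / 2 = k - 1 by omega, hS]
      simp
    · have hS : (S ℝ k).eval (2 * Real.cos (2 * Real.pi / m)) +
          (S ℝ (k - 1)).eval (2 * Real.cos (2 * Real.pi / m)) = 0 := by
        apply mul_right_cancel₀ hs
        rw [add_mul, chebyshevS_mul_sin, chebyshevS_mul_sin, zero_mul]
        have : (((k : ℤ) - 1 : ℤ) + 1 : ℝ) * (2 * Real.pi / m) =
            2 * Real.pi - (((k : ℤ) : ℝ) + 1) * (2 * Real.pi / m) := by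
          have : (m : ℝ) = 2 * k + 1 := by exact_mod_cast hk
          push_cast
          field_simp
          linear_combination -this
        rw [this, Real.sin_two_pi_sub]
        ring
      rw [show ((m : ℤ) - 2) / 2 = k - 1 by omega, show ((m : ℤ) - 1) / 2 = k by omega,
        show ((m : ℤ) - 3) / 2 = k - 1 by omega, show (m : ℤ) / 2 = k by omega, hS]
      simp

theorem geomReflection_mul_pow_ne_one {i j : B} (hij : i ≠ j) {n : ℕ} (hn : 0 < n)
    (h : M i j = 0 ∨ n < M i j) : (M.geomReflection i * M.geomReflection j) ^ n ≠ 1 := by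
  intro heq
  have hx := LinearEquiv.congr_fun heq (Finsupp.single i 1)
  rw [geomReflection, geomReflection, reflection_mul_reflection_pow_apply_self] at hx
  have hci := DFunLike.congr_fun hx i
  have hcj := DFunLike.congr_fun hx j
  simp only [LinearEquiv.coe_one, id, Finsupp.add_apply, Finsupp.smul_apply, smul_eq_mul,
    Finsupp.single_eq_same, Finsupp.single_eq_of_ne hij, Finsupp.single_eq_of_ne hij.symm,
    geomCoroot_single, mul_one, mul_zero, add_zero, zero_add] at hci hcj
  by_cases h0 : M i j = 0
  · have h0' : M j i = 0 := by rw [M.symmetric, h0]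
    norm_num [geomCartan, h0, h0'] at hcj
    omega
  have hlt : n < M i j := h.resolve_left h0
  rw [geomCartan_mul_sub_two _ h0] at hci hcj
  rcases Nat.lt_or_ge (M i j) 3 with h3 | h3
  · obtain ⟨rfl, h2⟩ : n = 1 ∧ M i j = 2 := by omega
    norm_num [h2] at hci
  · set m := M i j with hm
    have hm3 : (3 : ℝ) ≤ m := by exact_mod_cast h3
    have hs := sin_two_pi_div_pos h3
    have hcos : 0 < Real.cos (Real.pi / m) := by
      apply Real.cos_pos_of_mem_Ioo
      constructor
      · have : 0 < Real.pi / m := by have := Real.pi_pos; positivity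
        linarith [Real.pi_pos]
      · exact div_lt_div_of_pos_left Real.pi_pos (by norm_num) (by linarith)
    have hC : -M.geomCartan j i ≠ 0 := by
      rw [geomCartan_comm, geomCartan, if_neg h0]
      simp only [← hm]
      linarith
    have hS := (mul_eq_zero.1 hcj).resolve_right hC
    have e1 := chebyshevS_mul_sin m (n - 1)
    have e2 := chebyshevS_mul_sin m n
    rw [hS, zero_mul] at e1
    rw [hS, add_zero] at hci
    rw [hci, one_mul] at e2
    push_cast at e1 e2
    rw [sub_add_cancel] at e1
    rw [add_one_mul, Real.sin_add, ← e1, zero_mul, zero_add] at e2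
    have hcos1 : Real.cos (n * (2 * Real.pi / m)) = 1 :=
      mul_right_cancel₀ hs.ne' (by rw [← e2, one_mul])
    have hθ : 0 < 2 * Real.pi / m := by have := Real.pi_pos; positivity
    have hn' : (0 : ℝ) < n := by exact_mod_cast hn
    have hnm : (n : ℝ) < m := by exact_mod_cast hlt
    have hpos : 0 < n * (2 * Real.pi / m) := mul_pos hn' hθ
    have hltpi : n * (2 * Real.pi / m) < 2 * Real.pi := by
      calc n * (2 * Real.pi / m) < m * (2 * Real.pi / m) := by gcongr
        _ = 2 * Real.pi := by field_simp
    exact hpos.ne' ((Real.cos_eq_one_iff_of_lt_of_lt (by linarith [Real.pi_pos]) hltpi).1 hcos1)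

end CoxeterMatrix

namespace CoxeterSystem

open List

variable {B W : Type*} [Group W] {M : CoxeterMatrix B} (cs : CoxeterSystem M W)

theorem simple_mul_simple_pow_ne_one {i j : B} (hij : i ≠ j) {n : ℕ} (hn : 0 < n)
    (h : M i j = 0 ∨ n < M i j) : (cs.simple i * cs.simple j) ^ n ≠ 1 := by
  intro heq
  apply M.geomReflection_mul_pow_ne_one hij hn h
  have := congrArg (cs.lift ⟨_, M.geomReflection_isLiftable⟩) heq
  simpa only [map_pow, map_mul, lift_apply_simple, map_one] using this

theorem leftInvSeq_append (ω ω' : List B) : cs.leftInvSeq (ω ++ ω') =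
    cs.leftInvSeq ω ++ (cs.leftInvSeq ω').map (MulAut.conj (cs.wordProd ω)) := by
  induction ω with
  | nil => simp
  | cons i ω ih =>
    simp [leftInvSeq, ih, wordProd_cons, Function.comp_def]

theorem reverse_alternatingWord_two_mul_succ (i j : B) (n : ℕ) :
    (alternatingWord j i (2 * (n + 1))).reverse =
      i :: j :: (alternatingWord j i (2 * n)).reverse := by
  rw [show 2 * (n + 1) = 2 * n + 1 + 1 by ring, alternatingWord_succ, alternatingWord_succ]
  simp

theorem leftInvSeq_alternatingWord_two_mul (i j : B) (n : ℕ) :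
    cs.leftInvSeq (alternatingWord j i (2 * n)) =
      (range (2 * n)).map fun k ↦ cs.simple j * (cs.simple i * cs.simple j) ^ k := by
  apply ext_getElem
  · simp
  · intro k h _
    rw [getElem_leftInvSeq_alternatingWord cs j i n k (by simpa using h),
      prod_alternatingWord_eq_mul_pow]
    simp [show (2 * k + 1) / 2 = k by omega]

section Parity

variable [DecidableEq W]

/-- The action of a simple reflection on signed reflections, which records the parity of the
number of occurrences of a reflection in an inversion sequence. -/
def signedConj (i : B) : Function.End (W × ZMod 2) := fun p ↦
  (cs.simple i * p.1 * cs.simple i, p.2 + if p.1 = cs.simple i then 1 else 0)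

theorem prod_map_signedConj_reverse (ω : List B) (p : W × ZMod 2) :
    (ω.reverse.map cs.signedConj).prod p =
      ((cs.wordProd ω)⁻¹ * p.1 * cs.wordProd ω, p.2 + (cs.leftInvSeq ω).count p.1) := by
  induction ω using List.reverseRecOn with
  | nil => ext <;> simp [Function.End.one_def]
  | append_singleton ω i ih =>
    have hstep : ((ω ++ [i]).reverse.map cs.signedConj).prod p =
        cs.signedConj i ((ω.reverse.map cs.signedConj).prod p) := by
      simp only [reverse_append, reverse_singleton, singleton_append, map_cons, prod_cons]
      rfl
    rw [hstep, ih, leftInvSeq_append, wordProd_append]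
    simp only [signedConj, leftInvSeq_singleton, map_cons, map_nil, wordProd_singleton, mul_inv_rev,
      inv_simple, count_append, count_singleton, MulAut.conj_apply]
    ext
    · simp [mul_assoc]
    · have : ((cs.wordProd ω)⁻¹ * p.1 * cs.wordProd ω = cs.simple i) ↔
          cs.wordProd ω * cs.simple i * (cs.wordProd ω)⁻¹ = p.1 := by
        constructor
        · intro h
          rw [← h]
          group
        · intro h
          rw [← h]
          group
      by_cases h : cs.wordProd ω * cs.simple i * (cs.wordProd ω)⁻¹ = p.1
      · simp [this, h, add_assoc]
      · simp [this, h]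

theorem signedConj_isLiftable : M.IsLiftable cs.signedConj := by
  intro i j
  have hpow (n : ℕ) : (cs.signedConj i * cs.signedConj j) ^ n =
      ((alternatingWord j i (2 * n)).reverse.map cs.signedConj).prod := by
    induction n with
    | zero => simp [alternatingWord]
    | succ n ih =>
      rw [reverse_alternatingWord_two_mul_succ, pow_succ', ih]
      simp [mul_assoc]
  funext p
  rw [hpow, prod_map_signedConj_reverse, leftInvSeq_alternatingWord_two_mul,
    prod_alternatingWord_eq_mul_pow, two_mul, range_add, map_append, count_append, map_map]
  have hper : ((fun k ↦ cs.simple j * (cs.simple i * cs.simple j) ^ k) ∘ fun k ↦ M i j + k) =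
      fun k ↦ cs.simple j * (cs.simple i * cs.simple j) ^ k := by
    funext k
    simp [pow_add]
  rw [hper]
  ext
  · simp [← two_mul, Function.End.one_def]
  · simp [CharTwo.add_self_eq_zero, Function.End.one_def]

theorem count_leftInvSeq_eq {ω ω' : List B} (h : cs.wordProd ω = cs.wordProd ω') (t : W) :
    ((cs.leftInvSeq ω).count t : ZMod 2) = (cs.leftInvSeq ω').count t := by
  have key (η : List B) : cs.lift ⟨_, cs.signedConj_isLiftable⟩ (cs.wordProd η)⁻¹ =
      (η.reverse.map cs.signedConj).prod := by
    rw [← wordProd_reverse, wordProd, map_list_prod, map_map]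
    congr 1
    apply map_congr_left
    intro i _
    exact cs.lift_apply_simple cs.signedConj_isLiftable i
  have h1 := key ω
  rw [h, key ω'] at h1
  have h2 := congrFun h1 (t, 0)
  rw [prod_map_signedConj_reverse, prod_map_signedConj_reverse] at h2
  simpa using (congrArg Prod.snd h2).symm

end Parity

/-- The exchange property: a left descent of an element occurs in the left inversion sequence of
every word for that element. -/
theorem IsLeftDescent.mem_leftInvSeq {cs : CoxeterSystem M W} {ω : List B} {i : B}
    (h : cs.IsLeftDescent (cs.wordProd ω) i) : cs.simple i ∈ cs.leftInvSeq ω := by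
  classical
  obtain ⟨η, hη, hprod⟩ := cs.exists_isReduced (cs.simple i * cs.wordProd ω)
  have hω : cs.wordProd (i :: η) = cs.wordProd ω := by
    rw [wordProd_cons, ← hprod, simple_mul_simple_cancel_left]
  have hred : cs.IsReduced (i :: η) := by
    rw [IsReduced, hω, length_cons, ← hη.eq, ← hprod]
    exact (cs.isLeftDescent_iff.1 h).symm
  have hcount : (cs.leftInvSeq (i :: η)).count (cs.simple i) = 1 :=
    count_eq_one_of_mem hred.nodup_leftInvSeq (mem_cons_self)
  have hpar := cs.count_leftInvSeq_eq hω (cs.simple i)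
  rw [hcount] at hpar
  apply count_pos_iff.1
  by_contra h0
  simp [Nat.eq_zero_of_not_pos h0] at hpar

theorem nodup_leftInvSeq_alternatingWord {i j : B} (hij : i ≠ j) {n : ℕ}
    (hn : M i j = 0 ∨ n ≤ M i j) : (cs.leftInvSeq (alternatingWord i j n)).Nodup := by
  have main {a b : B} (hab : a ≠ b) (hn : M a b = 0 ∨ n ≤ M a b) :
      (cs.leftInvSeq ((alternatingWord b a (2 * (n + 1))).take n)).Nodup := by
    rw [leftInvSeq_take, leftInvSeq_alternatingWord_two_mul, ← map_take, take_range,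
      min_eq_left (by omega)]
    refine Nodup.map_on ?_ nodup_range
    have aux {k l : ℕ} (hl : l < n) (hkl : k < l) :
        (cs.simple a * cs.simple b) ^ k ≠ (cs.simple a * cs.simple b) ^ l := by
      intro h
      apply cs.simple_mul_simple_pow_ne_one hab (n := l - k) (by omega) (by omega)
      rw [pow_sub _ hkl.le, h, mul_inv_cancel]
    intro k hk l hl h
    have h' := mul_left_cancel h
    rw [mem_range] at hk hl
    rcases lt_trichotomy k l with hkl | hkl | hkl
    · exact (aux hl hkl h').elim
    · exact hkl
    · exact (aux hk hkl h'.symm).elim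
  by_cases hp : Even n
  · have := main hij.symm (by rwa [M.symmetric])
    rwa [listTake_alternatingWord _ _ _ _ (by omega), if_pos hp] at this
  · have := main hij hn
    rwa [listTake_alternatingWord _ _ _ _ (by omega), if_neg hp] at this

/-- An element with two distinct left descents has a reduced word starting with any alternating word
in them of length at most the order of their product. -/
theorem exists_eq_alternatingWord_mul {w : W} {i j : B} (hij : i ≠ j)
    (hi : cs.IsLeftDescent w i) (hj : cs.IsLeftDescent w j) {n : ℕ}
    (hn : M i j = 0 ∨ n ≤ M i j) :
    ∃ u, w = cs.wordProd (alternatingWord i j n) * u ∧ cs.length w = n + cs.length u := by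
  induction n with
  | zero => exact ⟨w, by simp [alternatingWord]⟩
  | succ n ih =>
    obtain ⟨u, hwu, hlen⟩ := ih (by omega)
    have hnodup := cs.nodup_leftInvSeq_alternatingWord hij hn
    rw [alternatingWord_succ'] at hnodup ⊢
    set x := if Even n then j else i with hx
    have hxw : cs.IsLeftDescent w x := by
      rw [hx]
      split_ifs <;> assumption
    obtain ⟨η, hη, rfl⟩ := cs.exists_isReduced u
    rw [← wordProd_append] at hwu
    rw [hwu] at hxw
    obtain ⟨k, hk, hxk⟩ := getElem_of_mem hxw.mem_leftInvSeq
    have hnk : n ≤ k := by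
      by_contra! hkn
      have hmem : cs.simple x ∈ cs.leftInvSeq (alternatingWord i j n) := by
        rw [← hxk, getElem_of_eq (cs.leftInvSeq_append _ _),
          getElem_append_left (by simpa using hkn)]
        exact getElem_mem _
      rw [leftInvSeq, nodup_cons] at hnodup
      exact hnodup.1 (mem_map.2 ⟨_, hmem, by simp⟩)
    have herase := cs.getD_leftInvSeq_mul_wordProd (alternatingWord i j n ++ η) k
    rw [getD_eq_getElem _ _ hk, hxk, eraseIdx_append_of_length_le (by simpa using hnk),
      wordProd_append _ (alternatingWord i j n) (eraseIdx _ _), ← hwu] at herase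
    have hw : w = cs.wordProd (x :: alternatingWord i j n) *
        cs.wordProd (η.eraseIdx (k - (alternatingWord i j n).length)) := by
      rw [wordProd_cons, mul_assoc, ← herase, simple_mul_simple_cancel_left]
    refine ⟨_, hw, ?_⟩
    have h1 := cs.length_mul_le (cs.wordProd (x :: alternatingWord i j n))
      (cs.wordProd (η.eraseIdx (k - (alternatingWord i j n).length)))
    rw [← hw] at h1
    have h2 := cs.length_wordProd_le (x :: alternatingWord i j n)
    have h3 := cs.length_wordProd_le (η.eraseIdx (k - (alternatingWord i j n).length))
    rw [length_leftInvSeq, length_append, length_alternatingWord] at hk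
    rw [length_eraseIdx_of_lt (by rw [length_alternatingWord]; omega)] at h3
    rw [hη.eq] at hlen
    rw [length_cons, length_alternatingWord] at h2
    omega

theorem coxeterMatrix_ne_zero_of_isLeftDescent {w : W} {i j : B} (hij : i ≠ j)
    (hi : cs.IsLeftDescent w i) (hj : cs.IsLeftDescent w j) : M i j ≠ 0 := by
  intro h
  obtain ⟨u, -, hu⟩ := cs.exists_eq_alternatingWord_mul hij hi hj (n := cs.length w + 1) (.inl h)
  omega

theorem IsReduced.isLeftDescent_cons {cs : CoxeterSystem M W} {i : B} {ω : List B}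
    (h : cs.IsReduced (i :: ω)) : cs.IsLeftDescent (cs.wordProd (i :: ω)) i := by
  rw [IsLeftDescent, h.eq, wordProd_cons, simple_mul_simple_cancel_left]
  exact Nat.lt_succ_of_le (cs.length_wordProd_le ω)

theorem IsReduced.of_cons {cs : CoxeterSystem M W} {i : B} {ω : List B}
    (h : cs.IsReduced (i :: ω)) : cs.IsReduced ω := by
  simpa using h.drop 1

theorem IsReduced.of_wordProd_eq {cs : CoxeterSystem M W} {ω ω' : List B}
    (h : cs.IsReduced ω) (hprod : cs.wordProd ω' = cs.wordProd ω)
    (hlen : ω'.length = ω.length) : cs.IsReduced ω' := by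
  rw [IsReduced, hprod, h.eq, hlen]

end CoxeterSystem

section IncreaseLabels

open CoxeterSystem

variable {B W W' : Type*} [Group W] [Group W'] {M M' : CoxeterMatrix B}
  {cs : CoxeterSystem M W} {cs' : CoxeterSystem M' W'}

/-- Words that are reduced for a Coxeter matrix stay reduced when its entries grow, and they do not
acquire new reduced words for the same element. -/
theorem CoxeterSystem.IsReduced.of_increase_labels
    (hM : ∀ s t : B, s ≠ t → M' s t ≠ 0 → M s t ≠ 0 ∧ M s t ≤ M' s t)
    {ω : List B} (hω : cs.IsReduced ω) :
    cs'.IsReduced ω ∧ ∀ ω' : List B, ω'.length = ω.length → cs'.wordProd ω' = cs'.wordProd ω →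
      cs.wordProd ω' = cs.wordProd ω := by
  induction hn : ω.length generalizing ω with
  | zero =>
    obtain rfl := List.length_eq_zero_iff.1 hn
    refine ⟨by simp [IsReduced], fun ω' hlen _ ↦ ?_⟩
    rw [List.length_eq_zero_iff.1 hlen]
  | succ n ih =>
    obtain ⟨s, a, rfl⟩ := List.exists_cons_of_length_eq_add_one hn
    have hn' : a.length = n := by simpa using hn
    obtain ⟨ha', haeq⟩ := ih hω.of_cons hn'
    have hω' : cs'.IsReduced (s :: a) := by
      by_contra hnot
      have hdesc : cs'.IsLeftDescent (cs'.wordProd a) s := by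
        by_contra hnd
        apply hnot
        rw [IsReduced, wordProd_cons, cs'.not_isLeftDescent_iff.1 hnd, ha'.eq, List.length_cons]
      obtain ⟨c, hc, hprod⟩ := cs'.exists_isReduced (cs'.simple s * cs'.wordProd a)
      have hlen := cs'.isLeftDescent_iff.1 hdesc
      rw [hprod, hc.eq, ha'.eq] at hlen
      have hsc := haeq (s :: c) (by rw [List.length_cons, hlen, hn'])
        (by rw [wordProd_cons, ← hprod, simple_mul_simple_cancel_left])
      have hle := cs.length_wordProd_le c
      have hred := hω.eq
      rw [wordProd_cons, ← hsc, wordProd_cons, simple_mul_simple_cancel_left,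
        List.length_cons] at hred
      omega
    refine ⟨hω', fun ω' hlen hprod ↦ ?_⟩
    obtain ⟨t, b, rfl⟩ := List.exists_cons_of_length_eq_add_one hlen
    have hlenb : b.length = n := by simpa using hlen
    by_cases hst : s = t
    · subst hst
      rw [wordProd_cons, wordProd_cons] at hprod ⊢
      rw [haeq b hlenb (mul_left_cancel hprod)]
    have hs := hω'.isLeftDescent_cons
    have ht := (hω'.of_wordProd_eq hprod (by rw [hlen, hn])).isLeftDescent_cons
    rw [hprod] at ht
    have hm0 := cs'.coxeterMatrix_ne_zero_of_isLeftDescent hst hs ht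
    obtain ⟨hM0, hMle⟩ := hM s t hst hm0
    obtain ⟨p, hp⟩ := Nat.exists_eq_succ_of_ne_zero hm0
    obtain ⟨i, j, hi, hj, hij, hmij, hMij⟩ : ∃ i j, (if Even p then j else i) = s ∧
        (if Even p then i else j) = t ∧ i ≠ j ∧ M' i j = M' s t ∧ M i j = M s t := by
      by_cases hpe : Even p
      · exact ⟨t, s, by simp [hpe], by simp [hpe], Ne.symm hst, M'.symmetric .., M.symmetric ..⟩
      · exact ⟨s, t, by simp [hpe], by simp [hpe], hst, rfl, rfl⟩
    have hcons₁ : alternatingWord i j (p + 1) = s :: alternatingWord i j p := by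
      rw [alternatingWord_succ', hi]
    have hcons₂ : alternatingWord j i (p + 1) = t :: alternatingWord j i p := by
      rw [alternatingWord_succ', hj]
    have hbraid' : cs'.wordProd (alternatingWord i j (p + 1)) =
        cs'.wordProd (alternatingWord j i (p + 1)) := by
      have := cs'.wordProd_braidWord_eq i j
      rwa [braidWord, braidWord, M'.symmetric j i, hmij, hp] at this
    obtain ⟨u, hu, hulen⟩ :
        ∃ u, cs'.wordProd (s :: a) = cs'.wordProd (alternatingWord i j (p + 1)) * u ∧
          cs'.length (cs'.wordProd (s :: a)) = p + 1 + cs'.length u := by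
      have hle : M' s t = 0 ∨ p + 1 ≤ M' s t := .inr hp.ge
      by_cases hpe : Even p
      · obtain ⟨rfl, rfl⟩ : j = s ∧ i = t := ⟨by simpa [hpe] using hi, by simpa [hpe] using hj⟩
        exact cs'.exists_eq_alternatingWord_mul hij ht hs (by rwa [hmij])
      · obtain ⟨rfl, rfl⟩ : i = s ∧ j = t := ⟨by simpa [hpe] using hi, by simpa [hpe] using hj⟩
        exact cs'.exists_eq_alternatingWord_mul hij hs ht hle
    obtain ⟨v, hv, rfl⟩ := cs'.exists_isReduced u
    rw [hω'.eq, hv.eq, hn] at hulen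
    have hu₂ := hu
    rw [hbraid', hcons₂, ← hprod, wordProd_cons, wordProd_cons, mul_assoc, ← wordProd_append] at hu₂
    rw [hcons₁, wordProd_cons, wordProd_cons, mul_assoc, ← wordProd_append] at hu
    have ha := haeq (alternatingWord i j p ++ v) (by simp; omega) (mul_left_cancel hu).symm
    have hsa : cs.wordProd (alternatingWord i j (p + 1) ++ v) = cs.wordProd (s :: a) := by
      rw [hcons₁, List.cons_append, wordProd_cons, ha, wordProd_cons]
    have hred := hω.of_wordProd_eq hsa (by simp; omega)
    have hMp : M i j = p + 1 := by
      by_contra hne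
      apply cs.not_isReduced_alternatingWord i j (m := p + 1) (by omega) (by omega)
      simpa using hred.take (p + 1)
    have hbraid : cs.wordProd (alternatingWord i j (p + 1)) =
        cs.wordProd (alternatingWord j i (p + 1)) := by
      have := cs.wordProd_braidWord_eq i j
      rwa [braidWord, braidWord, M.symmetric j i, hMp] at this
    have htb : cs.wordProd (t :: (alternatingWord j i p ++ v)) = cs.wordProd (s :: a) := by
      rw [← List.cons_append, ← hcons₂, wordProd_append, ← hbraid, ← wordProd_append, hsa]
    have hred₂ := hω.of_wordProd_eq htb (by simp; omega)
    have hb := (ih hred₂.of_cons (by simp; omega)).2 b hlenb (mul_left_cancel hu₂)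
    rw [← htb, wordProd_cons, wordProd_cons _ t (_ ++ _), hb]

theorem weakLE_of_weakLE_of_increase_labels
    (hM : ∀ s t : B, s ≠ t → M' s t ≠ 0 → M s t ≠ 0 ∧ M s t ≤ M' s t)
    {ω ω' : List B} (hω : cs.IsReduced ω) (hω' : cs.IsReduced ω')
    (h : weakLE cs' (cs'.wordProd ω) (cs'.wordProd ω')) :
    weakLE cs (cs.wordProd ω) (cs.wordProd ω') := by
  obtain ⟨u, hu, hprod⟩ := cs'.exists_isReduced ((cs'.wordProd ω)⁻¹ * cs'.wordProd ω')
  rw [weakLE, hprod, hu.eq, (hω.of_increase_labels hM).1.eq,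
    (hω'.of_increase_labels hM).1.eq] at h
  have heq := (hω'.of_increase_labels (cs' := cs') hM).2 (ω ++ u) (by simpa using h)
    (by rw [wordProd_append, ← hprod, mul_inv_cancel_left])
  have hred := hω'.of_wordProd_eq heq (by simpa using h)
  rw [weakLE, ← heq, hred.eq, hω.eq, wordProd_append, inv_mul_cancel_left, List.length_append]
  have := hred.drop ω.length
  rw [List.drop_left] at this
  rw [this.eq]

end IncreaseLabels

/-- Suppose `W'` is a Coxeter group obtained from `W` by increasing some edge
labels of the Coxeter diagram, i.e. for distinct `s, t` either
`m'(s,t) = m(s,t) = 2` or `m'(s,t) ≥ m(s,t) ≥ 3` (where the matrix entry `0`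
stands for `∞`).  If `W` has an infinite antichain in the right weak order,
then so does `W'`. -/
theorem infinite_antichain_of_increase_labels {B : Type*} {W W' : Type*}
    [Group W] [Group W']
    {M M' : CoxeterMatrix B} (cs : CoxeterSystem M W) (cs' : CoxeterSystem M' W')
    (hle : ∀ s t : B, s ≠ t →
      (M s t = 2 ∧ M' s t = 2) ∨
      ((M s t = 0 ∨ 3 ≤ M s t) ∧ (M' s t = 0 ∨ (M s t ≠ 0 ∧ M s t ≤ M' s t))))
    (hW : ∃ A : Set W, A.Infinite ∧ IsAntichain (weakLE cs) A) :
    ∃ A' : Set W', A'.Infinite ∧ IsAntichain (weakLE cs') A' := by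
  obtain ⟨A, hinf, hanti⟩ := hW
  have hM : ∀ s t : B, s ≠ t → M' s t ≠ 0 → M s t ≠ 0 ∧ M s t ≤ M' s t := by
    intro s t hst h0
    have := hle s t hst
    omega
  choose word hred hword using cs.exists_isReduced
  refine ⟨(fun w ↦ cs'.wordProd (word w)) '' A, hinf.image ?_, ?_⟩
  · intro v _ w _ h
    obtain ⟨hv', -⟩ := (hred v).of_increase_labels (cs' := cs') hM
    obtain ⟨hw', huniq⟩ := (hred w).of_increase_labels (cs' := cs') hM
    rw [hword v, hword w]
    exact huniq _ (by rw [← hv'.eq, ← hw'.eq]; exact congrArg cs'.length h) h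
  · rintro _ ⟨v, hv, rfl⟩ _ ⟨w, hw, rfl⟩ hne h
    have hvw := weakLE_of_weakLE_of_increase_labels hM (hred v) (hred w) h
    rw [← hword, ← hword] at hvw
    exact hanti hv hw (fun heq ↦ hne (by rw [heq])) hvw
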